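/- (Proposition 1(d), Asymptotic bias.) Suppose that for every 1 ≤ t ≤ T there are constants 0 < a_t ≤ b_t such that a_t ≤ w_t ≤ b_t almost surely under Q_t^1, and let V_t denote the variance of w_t under Q_t^1. Then lim_{K→∞} K · (log p(x_{1:T}) − L_MCFO^K) = Σ_{t=1}^T V_t / (2 p(x_t|x_{1:t-1})²). -/

import Mathlib

open MeasureTheory Filter

namespace MCFO

/-- The latent space at a single time step: `ℝ^dz`. -/
abbrev Zsp (dz : ℕ) : Type := Fin dz → ℝ

/-- Latent trajectories `z_{1:t+1}` (time is indexed from `0`, so index `t` corresponds to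
the paper's time `t+1`). -/
abbrev Traj (dz t : ℕ) : Type := Fin (t + 1) → Zsp dz

/-- Importance weights `w_t`.  Here `pz t z` denotes the joint density `p(z_{1:t+1}, x_{1:t+1})`
(with the observations fixed) and `q t h ζ` the proposal density `q(z_{t+1} | z_{1:t}, x_{1:t+1})`.
Division by zero in `ℝ` yields `0`, so the weight is `0` wherever the denominator vanishes. -/
noncomputable def w {dz : ℕ} (pz : (t : ℕ) → Traj dz t → ℝ)
    (q : (t : ℕ) → (Fin t → Zsp dz) → Zsp dz → ℝ) : (t : ℕ) → Traj dz t → ℝ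
  | 0, z => pz 0 z / q 0 Fin.elim0 (z 0)
  | t + 1, z =>
      pz (t + 1) z / (pz t (Fin.init z) * q (t + 1) (Fin.init z) (z (Fin.last (t + 1))))

/-- Density of the single-trajectory sampling law `Q_t^1`:
`p(z_{1:t-1} | x_{1:t-1}) · q(z_t | z_{1:t-1}, x_{1:t})` (in the paper's indexing). -/
noncomputable def Qdens {dz : ℕ} (pz : (t : ℕ) → Traj dz t → ℝ) (pX : ℕ → ℝ)
    (q : (t : ℕ) → (Fin t → Zsp dz) → Zsp dz → ℝ) : (t : ℕ) → Traj dz t → ℝ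
  | 0, z => q 0 Fin.elim0 (z 0)
  | t + 1, z => pz t (Fin.init z) / pX t * q (t + 1) (Fin.init z) (z (Fin.last (t + 1)))

/-- The law `Q_t^1` of a single sampled trajectory. -/
noncomputable def Q1 {dz : ℕ} (pz : (t : ℕ) → Traj dz t → ℝ) (pX : ℕ → ℝ)
    (q : (t : ℕ) → (Fin t → Zsp dz) → Zsp dz → ℝ) (t : ℕ) : Measure (Traj dz t) :=
  volume.withDensity fun z => ENNReal.ofReal (Qdens pz pX q t z)

/-- The law `Q_t^K` of `K` i.i.d. sampled trajectories. -/
noncomputable def QK {dz : ℕ} (pz : (t : ℕ) → Traj dz t → ℝ) (pX : ℕ → ℝ)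
    (q : (t : ℕ) → (Fin t → Zsp dz) → Zsp dz → ℝ) (t K : ℕ) :
    Measure (Fin K → Traj dz t) :=
  Measure.pi fun _ => Q1 pz pX q t

/-- The estimator `R_t^K = (1/K) ∑_i w_t(z_{1:t}^i)`. -/
noncomputable def R {dz : ℕ} (pz : (t : ℕ) → Traj dz t → ℝ)
    (q : (t : ℕ) → (Fin t → Zsp dz) → Zsp dz → ℝ) (t K : ℕ)
    (zs : Fin K → Traj dz t) : ℝ :=
  (∑ i, w pz q t (zs i)) / K

/-- The Monte Carlo objective `L_t^K = E_{Q_t^K}[log R_t^K]`. -/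
noncomputable def L {dz : ℕ} (pz : (t : ℕ) → Traj dz t → ℝ) (pX : ℕ → ℝ)
    (q : (t : ℕ) → (Fin t → Zsp dz) → Zsp dz → ℝ) (t K : ℕ) : ℝ :=
  ∫ zs, Real.log (R pz q t K zs) ∂(QK pz pX q t K)

/-- The Monte Carlo filtering objective `L_MCFO^K = ∑_{t=1}^T L_t^K`. -/
noncomputable def LMCFO {dz : ℕ} (pz : (t : ℕ) → Traj dz t → ℝ) (pX : ℕ → ℝ)
    (q : (t : ℕ) → (Fin t → Zsp dz) → Zsp dz → ℝ) (T K : ℕ) : ℝ :=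
  ∑ t ∈ Finset.range T, L pz pX q t K

/-- The conditional marginal likelihood `p(x_t | x_{1:t-1})` (with `p(x_1 | x_{1:0}) = p(x_1)`). -/
noncomputable def pcond (pX : ℕ → ℝ) : ℕ → ℝ
  | 0 => pX 0
  | t + 1 => pX (t + 1) / pX t

theorem abs_log_one_add_sub_le {α d : ℝ} (hα : 0 < α) (hd : α ≤ 1 + d) :
    |Real.log (1 + d) - d + d ^ 2 / 2| ≤ (10 + 4 / α) * |d| ^ 3 := by
  have hα4 : 0 < 4 / α := by positivity
  have hd3 : 0 ≤ |d| ^ 3 := by positivity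
  rcases le_or_gt |d| (1 / 2) with h | h
  · have key := Real.abs_log_sub_add_sum_range_le (x := -d) (by rw [abs_neg]; linarith) 2
    simp only [Finset.sum_range_succ, Finset.sum_range_zero, abs_neg, sub_neg_eq_add] at key
    norm_num at key
    calc |Real.log (1 + d) - d + d ^ 2 / 2| = |-d + d ^ 2 / 2 + Real.log (1 + d)| := by ring_nf
      _ ≤ |d| ^ 3 / (1 - |d|) := key
      _ ≤ |d| ^ 3 / (1 / 2) := by gcongr; linarith
      _ ≤ (10 + 4 / α) * |d| ^ 3 := by nlinarith [mul_nonneg hα4.le hd3]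
  · have hpos : 0 < 1 + d := hα.trans_le hd
    have hlog : |Real.log (1 + d)| ≤ |d| * (1 + 1 / α) := by
      have h1 := Real.log_le_sub_one_of_pos hpos
      have h2 := Real.one_sub_inv_le_log_of_pos hpos
      have h3 : |1 - (1 + d)⁻¹| ≤ |d| * (1 / α) := by
        have : 1 - (1 + d)⁻¹ = d * (1 + d)⁻¹ := by field_simp; ring
        rw [this, abs_mul, abs_of_pos (inv_pos.2 hpos), one_div]
        gcongr
      have h4 := neg_abs_le (1 - (1 + d)⁻¹)
      have h5 : 0 ≤ |d| * (1 / α) := by positivity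
      rw [abs_le]
      constructor <;> nlinarith [le_abs_self d, abs_nonneg d]
    have h4 : |d| ≤ 4 * |d| ^ 3 := by nlinarith [sq_nonneg |d|]
    have h2 : d ^ 2 ≤ 2 * |d| ^ 3 := by rw [← sq_abs]; nlinarith [sq_nonneg |d|]
    calc |Real.log (1 + d) - d + d ^ 2 / 2|
        ≤ |Real.log (1 + d)| + |d| + |d ^ 2 / 2| :=
          (abs_add_le _ _).trans (add_le_add_left (abs_sub _ _) _)
      _ ≤ |d| * (1 + 1 / α) + |d| + d ^ 2 / 2 := by
          rw [abs_of_nonneg (by positivity : 0 ≤ d ^ 2 / 2)]; gcongr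
      _ ≤ 4 * |d| ^ 3 * (1 + 1 / α) + 4 * |d| ^ 3 + 2 * |d| ^ 3 / 2 := by gcongr
      _ ≤ (10 + 4 / α) * |d| ^ 3 := by
          have : 4 / α = 4 * (1 / α) := by ring
          rw [this]; nlinarith

theorem _root_.ProbabilityTheory.HasSubgaussianMGF.integral_abs_pow_three_le {Ω : Type*}
    {mΩ : MeasurableSpace Ω} {P : Measure Ω} {X : Ω → ℝ} {c : NNReal}
    (h : ProbabilityTheory.HasSubgaussianMGF X c P) {s : ℝ} (hs : 0 < s) :
    ∫ ω, |X ω| ^ 3 ∂P ≤ 12 * Real.exp (c * s ^ 2 / 2) / s ^ 3 := by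
  have hbound : ∀ ω, |X ω| ^ 3 ≤ 6 / s ^ 3 * (Real.exp (s * X ω) + Real.exp (-s * X ω)) := by
    intro ω
    have h1 := Real.pow_div_factorial_le_exp (x := s * |X ω|) (by positivity) 3
    have h2 : Real.exp (s * |X ω|) ≤ Real.exp (s * X ω) + Real.exp (-s * X ω) := by
      rcases abs_cases (X ω) with ⟨e, -⟩ | ⟨e, -⟩ <;> rw [e]
      · linarith [Real.exp_pos (-s * X ω)]
      · rw [mul_neg, ← neg_mul]; linarith [Real.exp_pos (s * X ω)]
    have h3 : ((Nat.factorial 3 : ℕ) : ℝ) = 6 := by norm_num [Nat.factorial]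
    rw [h3] at h1
    calc |X ω| ^ 3 = 6 / s ^ 3 * ((s * |X ω|) ^ 3 / 6) := by field_simp
      _ ≤ _ := by gcongr; exact h1.trans h2
  have i1 := h.integrable_exp_mul s
  have i2 := h.integrable_exp_mul (-s)
  have m1 := h.mgf_le s
  have m2 := h.mgf_le (-s)
  rw [neg_sq] at m2
  calc ∫ ω, |X ω| ^ 3 ∂P
      ≤ ∫ ω, 6 / s ^ 3 * (Real.exp (s * X ω) + Real.exp (-s * X ω)) ∂P :=
        integral_mono_of_nonneg (ae_of_all _ fun ω => by positivity)
          ((i1.add i2).const_mul _) (ae_of_all _ hbound)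
    _ = 6 / s ^ 3 * (ProbabilityTheory.mgf X P s + ProbabilityTheory.mgf X P (-s)) := by
        rw [integral_const_mul, integral_add i1 i2]; rfl
    _ ≤ 6 / s ^ 3 * (Real.exp (c * s ^ 2 / 2) + Real.exp (c * s ^ 2 / 2)) := by gcongr
    _ = _ := by ring

open ProbabilityTheory in
theorem tendsto_mul_log_sub_integral_log_average {Ω : Type*} [MeasurableSpace Ω]
    {ν : Measure Ω} [IsProbabilityMeasure ν] {f : Ω → ℝ} (hf : AEMeasurable f ν) {a b : ℝ}
    (ha : 0 < a) (hab : ∀ᵐ ω ∂ν, f ω ∈ Set.Icc a b) :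
    Tendsto (fun K : ℕ => (K : ℝ) * (Real.log (∫ ω, f ω ∂ν) -
        ∫ ωs, Real.log ((∑ i, f (ωs i)) / K) ∂(Measure.pi fun _ : Fin K => ν))) atTop
      (nhds (variance f ν / (2 * (∫ ω, f ω ∂ν) ^ 2))) := by
  set m := ∫ ω, f ω ∂ν with hm
  have hfi : Integrable f ν := Integrable.of_mem_Icc a b hf hab
  have ham : a ≤ m := by
    have := integral_mono_ae (integrable_const a) hfi (hab.mono fun ω h => h.1)
    simpa using this
  have hm0 : 0 < m := ha.trans_le ham
  set c : NNReal := (‖b - a‖₊ / 2) ^ 2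
  set C : ℝ := (10 + 4 / (a / m)) * (12 * Real.exp (c / 2)) / m ^ 3
  have hC : 0 ≤ C := by positivity
  have hX2 : MemLp (fun ω => f ω - m) 2 ν :=
    (memLp_of_bounded hab hf.aestronglyMeasurable 2).sub (memLp_const m)
  have main : ∀ K : ℕ, 0 < K →
      |(K : ℝ) * (Real.log m -
        ∫ ωs, Real.log ((∑ i, f (ωs i)) / K) ∂(Measure.pi fun _ : Fin K => ν)) -
        variance f ν / (2 * m ^ 2)| ≤ C / √K := by
    intro K hK
    have hK' : (0 : ℝ) < K := by exact_mod_cast hK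
    set P : Measure (Fin K → Ω) := Measure.pi fun _ : Fin K => ν
    set S : (Fin K → Ω) → ℝ := fun ωs => ∑ i, (f (ωs i) - m) with hS
    set D : (Fin K → Ω) → ℝ := fun ωs => S ωs / (K * m) with hD
    have hsub : HasSubgaussianMGF S (∑ _i : Fin K, c) P := by
      refine HasSubgaussianMGF.sum_of_iIndepFun
        (X := fun (i : Fin K) (ωs : Fin K → Ω) => f (ωs i) - m)
        (iIndepFun_pi (X := fun _ ω => f ω - m) fun _ => hf.sub_const m) fun i _ => ?_
      refine HasSubgaussianMGF.of_map (X := fun ω => f ω - m)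
        (measurable_pi_apply i).aemeasurable ?_
      rw [(measurePreserving_eval (fun _ : Fin K => ν) i).map_eq]
      exact hasSubgaussianMGF_of_mem_Icc hf hab
    have hmem : ∀ᵐ ωs ∂P, ∀ i, f (ωs i) ∈ Set.Icc a b :=
      ae_all_iff.2 fun i =>
        (Measure.quasiMeasurePreserving_eval (fun _ : Fin K => ν) i).ae hab
    have hDR : ∀ ωs, 1 + D ωs = (∑ i, f (ωs i)) / K / m := by
      intro ωs
      simp only [hD, hS, Finset.sum_sub_distrib, Finset.sum_const, Finset.card_univ,
        Fintype.card_fin, nsmul_eq_mul]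
      field_simp
      ring
    have hR : ∀ᵐ ωs ∂P, a ≤ (∑ i, f (ωs i)) / K := by
      filter_upwards [hmem] with ωs h
      rw [le_div_iff₀ hK']
      calc a * K = ∑ _i : Fin K, a := by simp [mul_comm]
        _ ≤ _ := Finset.sum_le_sum fun i _ => (h i).1
    have hS1 : Integrable S P := hsub.integrable
    have hS2 : MemLp S 2 P := hsub.memLp 2
    have hS3 : MemLp S 3 P := hsub.memLp 3
    have hSmean : ∫ ωs, S ωs ∂P = 0 := by
      rw [hS, integral_finsetSum _ fun i _ => ?_]
      · refine Finset.sum_eq_zero fun i _ => ?_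
        rw [integral_comp_eval (μ := fun _ : Fin K => ν) (f := fun ω => f ω - m)
          hX2.aestronglyMeasurable]
        rw [integral_sub hfi (integrable_const m)]
        simp [hm]
      · exact integrable_comp_eval (μ := fun _ : Fin K => ν) (f := fun ω => f ω - m)
          (hfi.sub (integrable_const m))
    have hSvar : ∫ ωs, S ωs ^ 2 ∂P = K * variance f ν := by
      have h1 := variance_sum_pi (μ := fun _ : Fin K => ν) (X := fun _ ω => f ω - m)
        fun _ => hX2
      have h2 : (∑ i : Fin K, fun ωs : Fin K → Ω => f (ωs i) - m) = S := by
        ext ωs; simp [hS]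
      rw [h2, variance_of_integral_eq_zero hS1.aemeasurable hSmean] at h1
      rw [h1]
      simp [variance_sub_const hf.aestronglyMeasurable]
    have hS3le : ∫ ωs, |S ωs| ^ 3 ∂P ≤ 12 * Real.exp (c / 2) * (√K) ^ 3 := by
      have h := hsub.integral_abs_pow_three_le (s := 1 / √K) (by positivity)
      have e : ((∑ _i : Fin K, c : NNReal) : ℝ) * (1 / √K) ^ 2 / 2 = c / 2 := by
        rw [div_pow, Real.sq_sqrt hK'.le]
        simp
        field_simp
      rw [e] at h
      refine h.trans_eq ?_
      field_simp
    have hS3i : Integrable (fun ωs => |S ωs| ^ 3) P := by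
      simpa using hS3.integrable_norm_pow (by norm_num)
    have hrem : ∀ᵐ ωs ∂P, ‖Real.log ((∑ i, f (ωs i)) / K) - Real.log m - D ωs + D ωs ^ 2 / 2‖
        ≤ (10 + 4 / (a / m)) / (K * m) ^ 3 * |S ωs| ^ 3 := by
      filter_upwards [hR] with ωs h
      have h1 : a / m ≤ 1 + D ωs := by rw [hDR]; gcongr
      have h2 := abs_log_one_add_sub_le (div_pos ha hm0) h1
      rw [hDR, Real.log_div (ha.trans_le h).ne' hm0.ne'] at h2
      rw [Real.norm_eq_abs]
      refine h2.trans_eq ?_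
      rw [hD, abs_div, abs_of_pos (by positivity : 0 < K * m)]
      ring
    have hmeas : AEStronglyMeasurable (fun ωs : Fin K → Ω => Real.log ((∑ i, f (ωs i)) / K)) P := by
      refine (Real.measurable_log.comp_aemeasurable
        (AEMeasurable.div_const ?_ _)).aestronglyMeasurable
      exact Finset.aemeasurable_fun_sum _ fun i _ =>
        hf.comp_quasiMeasurePreserving (Measure.quasiMeasurePreserving_eval _ i)
    have hDi : Integrable D P := hS1.div_const _
    have hD2i : Integrable (fun ωs => D ωs ^ 2 / 2) P := by
      simp only [hD, div_pow]
      exact (hS2.integrable_sq.div_const _).div_const _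
    have hremi : Integrable (fun ωs => Real.log ((∑ i, f (ωs i)) / K) - Real.log m - D ωs
        + D ωs ^ 2 / 2) P :=
      (hS3i.const_mul _).mono' (((hmeas.sub aestronglyMeasurable_const).sub
        hDi.aestronglyMeasurable).add hD2i.aestronglyMeasurable) hrem
    have hlogi : Integrable (fun ωs : Fin K → Ω => Real.log ((∑ i, f (ωs i)) / K)) P := by
      refine (((hremi.sub hD2i).add hDi).add (integrable_const (Real.log m))).congr
        (ae_of_all _ fun ωs => ?_)
      simp only [Pi.add_apply, Pi.sub_apply]
      ring
    have hDmean : ∫ ωs, D ωs ∂P = 0 := by rw [hD, integral_div, hSmean, zero_div]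
    have hDvar : ∫ ωs, D ωs ^ 2 / 2 ∂P = variance f ν / (2 * m ^ 2) / K := by
      simp only [hD, div_pow]
      rw [integral_div, integral_div, hSvar]
      field_simp
    have hint : ∫ ωs, (Real.log ((∑ i, f (ωs i)) / K) - Real.log m - D ωs + D ωs ^ 2 / 2) ∂P
        = ∫ ωs, Real.log ((∑ i, f (ωs i)) / K) ∂P - Real.log m
          + variance f ν / (2 * m ^ 2) / K := by
      have h1 : Integrable (fun ωs : Fin K → Ω =>
          Real.log ((∑ i, f (ωs i)) / K) - Real.log m) P := hlogi.sub (integrable_const _)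
      have h2 : Integrable (fun ωs : Fin K → Ω =>
          Real.log ((∑ i, f (ωs i)) / K) - Real.log m - D ωs) P := h1.sub hDi
      rw [integral_add h2 hD2i, integral_sub h1 hDi,
        integral_sub hlogi (integrable_const _), hDmean, hDvar]
      simp
    have hle := norm_integral_le_of_norm_le (hS3i.const_mul _) hrem
    rw [hint, integral_const_mul, Real.norm_eq_abs] at hle
    have e : (K : ℝ) * (Real.log m - ∫ ωs, Real.log ((∑ i, f (ωs i)) / K) ∂P) -
        variance f ν / (2 * m ^ 2) = -(K * (∫ ωs, Real.log ((∑ i, f (ωs i)) / K) ∂P - Real.log m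
          + variance f ν / (2 * m ^ 2) / K)) := by
      field_simp
      ring
    rw [e, abs_neg, abs_mul, abs_of_pos hK']
    calc (K : ℝ) * |_| ≤ K * ((10 + 4 / (a / m)) / (K * m) ^ 3 *
          (12 * Real.exp (c / 2) * (√K) ^ 3)) := by
          gcongr
          exact hle.trans (by gcongr)
      _ = C / √K := by
          obtain ⟨r, hr, hrK⟩ : ∃ r : ℝ, 0 < r ∧ (K : ℝ) = r ^ 2 :=
            ⟨√K, by positivity, (Real.sq_sqrt hK'.le).symm⟩
          simp only [C]
          rw [hrK, Real.sqrt_sq hr.le]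
          field_simp
  rw [tendsto_iff_norm_sub_tendsto_zero]
  refine squeeze_zero' (Eventually.of_forall fun K => norm_nonneg _)
    ((eventually_gt_atTop 0).mono main) ?_
  exact (Real.tendsto_sqrt_atTop.comp tendsto_natCast_atTop_atTop).const_div_atTop C

theorem integrable_of_integral_pos {α : Type*} [MeasurableSpace α] {P : Measure α} {f : α → ℝ}
    (h : 0 < ∫ x, f x ∂P) : Integrable f P :=
  of_not_not fun hn => h.ne' (integral_undef hn)

theorem lintegral_init_mul_last {α : Type*} [MeasureSpace α] [SigmaFinite (volume : Measure α)]
    {n : ℕ} {g : (Fin n → α) → α → ENNReal} (hg : Measurable (Function.uncurry g)) :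
    ∫⁻ z : Fin (n + 1) → α, g (Fin.init z) (z (Fin.last n)) = ∫⁻ h, ∫⁻ ζ, g h ζ := by
  have e := (volume_preserving_piFinSuccAbove (fun _ : Fin (n + 1) => α)
    (Fin.last n)).lintegral_comp (f := fun p => g p.2 p.1) (hg.comp measurable_swap)
  rw [Measure.volume_eq_prod, lintegral_prod_symm (fun p : α × (Fin n → α) => g p.2 p.1)
    (hg.comp measurable_swap).aemeasurable] at e
  rw [← e]
  congr! with z
  ext i
  simp [MeasurableEquiv.piFinSuccAbove, Fin.init]

theorem measurable_init {α : Type*} [MeasurableSpace α] {n : ℕ} :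
    Measurable (Fin.init : (Fin (n + 1) → α) → (Fin n → α)) :=
  measurable_pi_lambda _ fun _ => measurable_pi_apply _

section

variable {dz : ℕ} {pz : (t : ℕ) → Traj dz t → ℝ} {pX : ℕ → ℝ}
    {q : (t : ℕ) → (Fin t → Zsp dz) → Zsp dz → ℝ}

theorem measurable_proposal (hq_meas : ∀ t, Measurable (Function.uncurry (q t))) (t : ℕ) :
    Measurable fun z : Traj dz t => q t (Fin.init z) (z (Fin.last t)) :=
  (hq_meas t).comp (measurable_init.prodMk (measurable_pi_apply _))

theorem Qdens_zero (z : Traj dz 0) :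
    Qdens pz pX q 0 z = q 0 (Fin.init z) (z (Fin.last 0)) := by
  rw [Subsingleton.elim (Fin.init z : Fin 0 → Zsp dz) Fin.elim0]; rfl

theorem w_zero (z : Traj dz 0) :
    w pz q 0 z = pz 0 z / q 0 (Fin.init z) (z (Fin.last 0)) := by
  rw [Subsingleton.elim (Fin.init z : Fin 0 → Zsp dz) Fin.elim0]; rfl

theorem measurable_w (hpz_meas : ∀ t, Measurable (pz t))
    (hq_meas : ∀ t, Measurable (Function.uncurry (q t))) (t : ℕ) : Measurable (w pz q t) := by
  cases t with
  | zero =>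
    simp only [funext w_zero]
    exact (hpz_meas 0).div (measurable_proposal hq_meas 0)
  | succ t =>
    exact (hpz_meas _).div (((hpz_meas t).comp measurable_init).mul
      (measurable_proposal hq_meas (t + 1)))

theorem measurable_Qdens (hpz_meas : ∀ t, Measurable (pz t))
    (hq_meas : ∀ t, Measurable (Function.uncurry (q t))) (t : ℕ) :
    Measurable (Qdens pz pX q t) := by
  cases t with
  | zero =>
    simp only [funext Qdens_zero]
    exact measurable_proposal hq_meas 0
  | succ t =>
    exact (((hpz_meas t).comp measurable_init).div_const _).mul
      (measurable_proposal hq_meas (t + 1))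

theorem Qdens_nonneg (hpz_nonneg : ∀ t z, 0 ≤ pz t z) (hq_nonneg : ∀ t h ζ, 0 ≤ q t h ζ)
    (hpX_pos : ∀ t, 0 < pX t) (t : ℕ) (z : Traj dz t) : 0 ≤ Qdens pz pX q t z := by
  cases t with
  | zero => exact hq_nonneg _ _ _
  | succ t => exact mul_nonneg (div_nonneg (hpz_nonneg _ _) (hpX_pos _).le) (hq_nonneg _ _ _)

theorem isProbabilityMeasure_Q1 (hpz_meas : ∀ t, Measurable (pz t))
    (hpz_nonneg : ∀ t z, 0 ≤ pz t z) (hq_meas : ∀ t, Measurable (Function.uncurry (q t)))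
    (hq_nonneg : ∀ t h ζ, 0 ≤ q t h ζ) (hq_prob : ∀ t h, ∫ ζ, q t h ζ = 1)
    (hpX : ∀ t, pX t = ∫ z, pz t z) (hpX_pos : ∀ t, 0 < pX t) (t : ℕ) :
    IsProbabilityMeasure (Q1 pz pX q t) := by
  have hq1 : ∀ t h, ∫⁻ ζ, ENNReal.ofReal (q t h ζ) = 1 := fun t h => by
    rw [← ofReal_integral_eq_lintegral_ofReal
      (integrable_of_integral_pos (by rw [hq_prob]; exact one_pos))
      (ae_of_all _ (hq_nonneg t h)), hq_prob, ENNReal.ofReal_one]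
  constructor
  rw [Q1, withDensity_apply _ MeasurableSet.univ, Measure.restrict_univ]
  cases t with
  | zero =>
    simp only [Qdens_zero]
    rw [lintegral_init_mul_last (g := fun h ζ => ENNReal.ofReal (q 0 h ζ))
      (hq_meas 0).ennreal_ofReal]
    simp only [hq1, lintegral_one]
    simp [volume_pi]
  | succ t =>
    have hm : Measurable fun h => ENNReal.ofReal (pz t h / pX t) :=
      ((hpz_meas t).div_const _).ennreal_ofReal
    simp only [Qdens, ENNReal.ofReal_mul (div_nonneg (hpz_nonneg t _) (hpX_pos t).le)]
    rw [lintegral_init_mul_last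
      (g := fun h ζ => ENNReal.ofReal (pz t h / pX t) * ENNReal.ofReal (q (t + 1) h ζ))
      ((hm.comp measurable_fst).mul (hq_meas (t + 1)).ennreal_ofReal)]
    have : ∀ h, Measurable fun ζ => ENNReal.ofReal (q (t + 1) h ζ) := fun h =>
      ((hq_meas (t + 1)).comp measurable_prodMk_left).ennreal_ofReal
    simp only [lintegral_const_mul _ (this _), hq1, mul_one]
    rw [← ofReal_integral_eq_lintegral_ofReal
      ((integrable_of_integral_pos (by rw [← hpX]; exact hpX_pos t)).div_const _)
      (ae_of_all _ fun h => div_nonneg (hpz_nonneg t h) (hpX_pos t).le), integral_div, ← hpX,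
      div_self (hpX_pos t).ne', ENNReal.ofReal_one]

theorem Qdens_mul_w (hpX_pos : ∀ t, 0 < pX t) (hpz_nonneg : ∀ t z, 0 ≤ pz t z)
    (hq_pos0 : ∀ z : Traj dz 0, 0 < pz 0 z → 0 < q 0 Fin.elim0 (z 0))
    (hq_pos : ∀ t (z : Traj dz (t + 1)), 0 < pz (t + 1) z →
      0 < q (t + 1) (Fin.init z) (z (Fin.last (t + 1))))
    (hsupp : ∀ t (z : Traj dz (t + 1)), pz t (Fin.init z) = 0 → pz (t + 1) z = 0)
    (t : ℕ) (z : Traj dz t) :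
    Qdens pz pX q t z * w pz q t z = pcond pX t / pX t * pz t z := by
  rcases (hpz_nonneg t z).eq_or_lt with h0 | hpos
  · cases t <;> simp [w, ← h0]
  · have hX := (hpX_pos t).ne'
    cases t with
    | zero =>
      have h1 := (hq_pos0 z hpos).ne'
      simp only [w, Qdens, pcond]
      field_simp
    | succ t =>
      have h1 := (hq_pos t z hpos).ne'
      have h2 : pz t (Fin.init z) ≠ 0 := fun h => hpos.ne' (hsupp t z h)
      simp only [w, Qdens, pcond]
      field_simp

theorem integral_w (hpz_meas : ∀ t, Measurable (pz t)) (hpz_nonneg : ∀ t z, 0 ≤ pz t z)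
    (hq_meas : ∀ t, Measurable (Function.uncurry (q t))) (hq_nonneg : ∀ t h ζ, 0 ≤ q t h ζ)
    (hq_pos0 : ∀ z : Traj dz 0, 0 < pz 0 z → 0 < q 0 Fin.elim0 (z 0))
    (hq_pos : ∀ t (z : Traj dz (t + 1)), 0 < pz (t + 1) z →
      0 < q (t + 1) (Fin.init z) (z (Fin.last (t + 1))))
    (hpX : ∀ t, pX t = ∫ z, pz t z) (hpX_pos : ∀ t, 0 < pX t)
    (hsupp : ∀ t (z : Traj dz (t + 1)), pz t (Fin.init z) = 0 → pz (t + 1) z = 0) (t : ℕ) :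
    ∫ z, w pz q t z ∂(Q1 pz pX q t) = pcond pX t := by
  rw [Q1, integral_withDensity_eq_integral_toReal_smul
    (measurable_Qdens hpz_meas hq_meas t).ennreal_ofReal
    (ae_of_all _ fun _ => ENNReal.ofReal_lt_top)]
  simp only [ENNReal.toReal_ofReal (Qdens_nonneg hpz_nonneg hq_nonneg hpX_pos t _), smul_eq_mul,
    Qdens_mul_w hpX_pos hpz_nonneg hq_pos0 hq_pos hsupp]
  rw [integral_const_mul, ← hpX, div_mul_cancel₀ _ (hpX_pos t).ne']

theorem sum_log_pcond (hpX_pos : ∀ t, 0 < pX t) (n : ℕ) :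
    ∑ t ∈ Finset.range (n + 1), Real.log (pcond pX t) = Real.log (pX n) := by
  induction n with
  | zero => simp [pcond]
  | succ n ih =>
    rw [Finset.sum_range_succ, ih, pcond, Real.log_div (hpX_pos _).ne' (hpX_pos _).ne']
    ring

end

/-- Proposition 1(d), Asymptotic bias: if each importance weight `w_t` is
bounded away from `0` and `∞` under `Q_t^1`, then
`lim_{K→∞} K (log p(x_{1:T}) − L_MCFO^K) = ∑_{t=1}^T V_t / (2 p(x_t|x_{1:t-1})²)`,
where `V_t` is the variance of `w_t` under `Q_t^1`. -/
theorem LMCFO_asymptotic_bias {dz T : ℕ} (hdz : 1 ≤ dz) (hT : 1 ≤ T)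
    (pz : (t : ℕ) → Traj dz t → ℝ) (pX : ℕ → ℝ)
    (q : (t : ℕ) → (Fin t → Zsp dz) → Zsp dz → ℝ)
    (hpz_meas : ∀ t, Measurable (pz t))
    (hpz_nonneg : ∀ t z, 0 ≤ pz t z)
    (hq_meas : ∀ t, Measurable (Function.uncurry (q t)))
    (hq_nonneg : ∀ t h ζ, 0 ≤ q t h ζ)
    (hq_prob : ∀ t h, ∫ ζ, q t h ζ = 1)
    (hq_pos0 : ∀ z : Traj dz 0, 0 < pz 0 z → 0 < q 0 Fin.elim0 (z 0))
    (hq_pos : ∀ t (z : Traj dz (t + 1)), 0 < pz (t + 1) z →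
      0 < q (t + 1) (Fin.init z) (z (Fin.last (t + 1))))
    (hpX : ∀ t, pX t = ∫ z, pz t z)
    (hpX_pos : ∀ t, 0 < pX t)
    (hsupp : ∀ t (z : Traj dz (t + 1)), pz t (Fin.init z) = 0 → pz (t + 1) z = 0)
    (hint : ∀ t K, Integrable (fun zs => Real.log (R pz q t K zs)) (QK pz pX q t K))
    (hbdd : ∀ t < T, ∃ a b : ℝ, 0 < a ∧ a ≤ b ∧
      ∀ᵐ z ∂(Q1 pz pX q t), a ≤ w pz q t z ∧ w pz q t z ≤ b) :
    Tendsto (fun K : ℕ => (K : ℝ) * (Real.log (pX (T - 1)) - LMCFO pz pX q T K)) atTop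
      (nhds (∑ t ∈ Finset.range T,
        ProbabilityTheory.variance (w pz q t) (Q1 pz pX q t) / (2 * pcond pX t ^ 2))) := by
  have hlog : Real.log (pX (T - 1)) = ∑ t ∈ Finset.range T, Real.log (pcond pX t) := by
    rw [← sum_log_pcond hpX_pos, Nat.sub_add_cancel hT]
  simp only [hlog, LMCFO, ← Finset.sum_sub_distrib, Finset.mul_sum]
  refine tendsto_finsetSum _ fun t ht => ?_
  obtain ⟨a, b, ha, -, hab⟩ := hbdd t (Finset.mem_range.1 ht)
  have := isProbabilityMeasure_Q1 hpz_meas hpz_nonneg hq_meas hq_nonneg hq_prob hpX hpX_pos t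
  rw [← integral_w hpz_meas hpz_nonneg hq_meas hq_nonneg hq_pos0 hq_pos hpX hpX_pos hsupp t]
  exact tendsto_mul_log_sub_integral_log_average (measurable_w hpz_meas hq_meas t).aemeasurable
    ha hab

end MCFO
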